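/- Let S be a string of length N over a linearly ordered alphabet with RL factorization a_1^{p_1}⋯a_n^{p_n} and s-factorization f_1⋯f_m. Fix j, let ℓ = |f_1⋯f_{j-1}| + 1 be the starting position of f_j, let d = min{ t : Σ_{i=1}^{t} p_i ≥ ℓ } + 1 (so the (d−1)-th RL factor contains position ℓ), and let q = Σ_{i=1}^{d-1} p_i − ℓ + 1 (so 1 ≤ q ≤ p_{d-1} and S[ℓ..ℓ+q−1] = a_{d-1}^q). Let k = max({ p_i : a_i = a_{d-1}, 1 ≤ i ≤ d−2 } ∪ {0}). If q = p_{d-1} and q > k, then |f_j| = max{k, 1}. -/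

import Mathlib

variable {α : Type*}

/-- Decompress a run-length encoding: each pair `(a, p)` stands for `a^p`. -/
def rleDecode (l : List (α × ℕ)) : List α :=
  (l.map fun ap => List.replicate ap.2 ap.1).flatten

/-- `l` is the run-length factorization of `S`: it decodes to `S`, all exponents are
positive, and adjacent factors carry distinct characters. -/
def IsRLE (S : List α) (l : List (α × ℕ)) : Prop :=
  rleDecode l = S ∧ (∀ ap ∈ l, 1 ≤ ap.2) ∧ l.Chain' (fun x y => x.1 ≠ y.1)

/-- `f` has an occurrence in `S` starting at a (0-indexed) position strictly before `ℓ`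
(the occurrence may extend past position `ℓ`, allowing self-references). -/
def OccursBefore (S : List α) (ℓ : ℕ) (f : List α) : Prop :=
  ∃ j < ℓ, f <+: S.drop j

/-- `fs` is the s-factorization of `S` (LZ factorization with self-references):
the factors are nonempty and concatenate to `S`; the first factor is the first
character; and each subsequent factor starting at (0-indexed) position `ℓ`
with first character `c` is `[c]` if `c` does not occur before position `ℓ`,
and otherwise is the longest prefix of the remainder that has an occurrence
in `S` starting strictly before position `ℓ` (possibly overlapping itself). -/
def IsSFactorization (S : List α) (fs : List (List α)) : Prop :=
  fs.flatten = S ∧ (∀ f ∈ fs, f ≠ []) ∧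
  ∀ i (h : i < fs.length), ∀ c, (fs.get ⟨i, h⟩).head? = some c →
    ((c ∉ (fs.take i).flatten → fs.get ⟨i, h⟩ = [c]) ∧
     (c ∈ (fs.take i).flatten →
        OccursBefore S ((fs.take i).flatten).length (fs.get ⟨i, h⟩) ∧
        ∀ f', f' <+: S.drop ((fs.take i).flatten).length →
          OccursBefore S ((fs.take i).flatten).length f' →
          f'.length ≤ (fs.get ⟨i, h⟩).length))

@[simp] lemma rleDecode_nil : rleDecode ([] : List (α × ℕ)) = [] := rfl

@[simp] lemma rleDecode_cons (x : α × ℕ) (l : List (α × ℕ)) :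
    rleDecode (x :: l) = List.replicate x.2 x.1 ++ rleDecode l := rfl

lemma rleDecode_append (l₁ l₂ : List (α × ℕ)) :
    rleDecode (l₁ ++ l₂) = rleDecode l₁ ++ rleDecode l₂ := by
  simp [rleDecode]

lemma length_rleDecode (l : List (α × ℕ)) :
    (rleDecode l).length = (l.map (·.2)).sum := by
  induction l with
  | nil => rfl
  | cons x l ih => simp [ih]

/-- The largest exponent of a run of `a`, or `0` if there is none. -/
def maxRun [DecidableEq α] (a : α) (l : List (α × ℕ)) : ℕ :=
  ((l.filter fun ap => ap.1 = a).map (·.2)).foldr max 0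

lemma maxRun_cons [DecidableEq α] (a : α) (x : α × ℕ) (l : List (α × ℕ)) :
    maxRun a (x :: l) = if x.1 = a then max x.2 (maxRun a l) else maxRun a l := by
  by_cases h : x.1 = a <;> simp [maxRun, h]

lemma le_maxRun_of_mem [DecidableEq α] {a : α} {p : ℕ} {l : List (α × ℕ)}
    (h : (a, p) ∈ l) : p ≤ maxRun a l := by
  induction l with
  | nil => simp at h
  | cons x l ih =>
    rw [maxRun_cons]
    rcases List.mem_cons.1 h with rfl | h
    · simp
    · have := ih h
      split_ifs <;> omega

lemma maxRun_mem [DecidableEq α] {a : α} {l : List (α × ℕ)} (h : maxRun a l ≠ 0) :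
    (a, maxRun a l) ∈ l := by
  induction l with
  | nil => simp [maxRun] at h
  | cons x l ih =>
    obtain ⟨b, r⟩ := x
    rw [maxRun_cons] at h ⊢
    split_ifs at h ⊢ with hb
    · simp only at hb h ⊢
      subst hb
      rcases le_total r (maxRun b l) with hr | hr
      · rw [max_eq_right hr] at h ⊢
        exact List.mem_cons_of_mem _ (ih h)
      · simp [max_eq_left hr]
    · exact List.mem_cons_of_mem _ (ih h)

lemma mem_rleDecode {a : α} {l : List (α × ℕ)} :
    a ∈ rleDecode l ↔ ∃ p, p ≠ 0 ∧ (a, p) ∈ l := by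
  induction l with
  | nil => simp
  | cons x l ih =>
    obtain ⟨b, r⟩ := x
    simp only [rleDecode_cons, List.mem_append, List.mem_replicate, ih, List.mem_cons,
      Prod.mk.injEq]
    constructor
    · rintro (⟨hr, rfl⟩ | ⟨p, hp, h⟩)
      · exact ⟨r, hr, Or.inl ⟨rfl, rfl⟩⟩
      · exact ⟨p, hp, Or.inr h⟩
    · rintro ⟨p, hp, ⟨rfl, rfl⟩ | h⟩
      · exact Or.inl ⟨hp, rfl⟩
      · exact Or.inr ⟨p, hp, h⟩

lemma mem_rleDecode_iff_maxRun_ne_zero [DecidableEq α] {a : α} {l : List (α × ℕ)} :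
    a ∈ rleDecode l ↔ maxRun a l ≠ 0 := by
  rw [mem_rleDecode]
  constructor
  · rintro ⟨p, hp, h⟩
    have := le_maxRun_of_mem h
    omega
  · exact fun h => ⟨_, h, maxRun_mem h⟩

lemma occursBefore_replicate_of_mem {a : α} {p : ℕ} {l : List (α × ℕ)} (T : List α)
    (hp : p ≠ 0) (h : (a, p) ∈ l) :
    OccursBefore (rleDecode l ++ T) (rleDecode l).length (List.replicate p a) := by
  obtain ⟨l₁, l₂, rfl⟩ := List.append_of_mem h
  refine ⟨(rleDecode l₁).length, ?_, ?_⟩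
  · simp [rleDecode_append]
    omega
  · simp [rleDecode_append]

/-- A block of `a`s starting strictly before a run of `a` is contained in an earlier run. -/
lemma le_maxRun_of_getElem? [DecidableEq α] {a : α} {p : ℕ} {T : List α} {m : ℕ} :
    ∀ {l : List (α × ℕ)} {j : ℕ}, (∀ x ∈ l, 1 ≤ x.2) →
      (l ++ [(a, p)]).IsChain (fun x y => x.1 ≠ y.1) → j < (rleDecode l).length →
      (∀ i < m, (rleDecode l ++ T)[j + i]? = some a) → m ≤ maxRun a l
  | [], j, _, _, hj, _ => by simp at hj
  | (b, r) :: l, j, hpos, hch, hj, hrun => by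
    have ih := fun j => le_maxRun_of_getElem? (a := a) (p := p) (T := T) (m := m) (l := l) (j := j)
      (fun x hx => hpos x (List.mem_cons_of_mem _ hx)) (by simpa using hch.tail)
    have hlen : (rleDecode ((b, r) :: l)).length = r + (rleDecode l).length := by simp
    rw [hlen] at hj
    have hright : ∀ i, r ≤ i →
        (rleDecode ((b, r) :: l) ++ T)[i]? = (rleDecode l ++ T)[i - r]? := by
      intro i hi
      rw [rleDecode_cons, List.append_assoc, List.getElem?_append_right (by simpa using hi)]
      simp
    rw [maxRun_cons]
    rcases le_or_gt r j with hjr | hjr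
    · have := ih (j - r) (by omega) fun i hi => by
        rw [← hrun i hi, hright _ (by omega)]
        congr 1
        omega
      split_ifs <;> omega
    · rcases Nat.eq_zero_or_pos m with rfl | hm
      · simp
      have hba : b = a := by
        have h0 := hrun 0 hm
        rw [rleDecode_cons, List.append_assoc,
          List.getElem?_append_left (by simpa using hjr)] at h0
        simpa [List.getElem?_replicate, hjr] using h0
      subst hba
      simp only [if_true]
      by_contra! hlt
      have hnext := hrun (r - j) (by omega)
      rw [hright _ (by omega)] at hnext
      cases l with
      | nil => simp at hch
      | cons x l =>
        have hx := hpos x (by simp)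
        have hne : b ≠ x.1 := by
          rw [List.cons_append, List.cons_append, List.isChain_cons_cons] at hch
          exact hch.1
        have hidx : j + (r - j) - r = 0 := by omega
        rw [hidx, rleDecode_cons, List.append_assoc,
          List.getElem?_append_left (by rwa [List.length_replicate])] at hnext
        rw [List.getElem?_replicate_of_lt hx] at hnext
        exact hne (Option.some.inj hnext).symm

/-- Case 1 of Lemma 4. Suppose the s-factor `f_j` (0-indexed `jf`)
starts at position `ℓ0` (0-indexed), inside the RL factor with 0-indexed index `d0`
(so `Σ_{i ≤ d0} p_i ≤ ℓ0 < Σ_{i ≤ d0+1} p_i`, 0-indexed sums over `take`), and let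
`q = Σ_{i ≤ d0+1} p_i − ℓ0` be the number of remaining positions in that run. Let
`k` be the maximum exponent of an earlier RL factor with the same character
(`0` if there is none). If `q = p_{d0}` and `q > k`, then `|f_j| = max k 1`. -/
theorem sfactor_length_case1 [DecidableEq α] (S : List α) (hS : S ≠ [])
    (l : List (α × ℕ)) (hl : IsRLE S l)
    (fs : List (List α)) (hfs : IsSFactorization S fs)
    (jf : ℕ) (hjf : jf < fs.length)
    (d0 : ℕ) (hd0 : d0 < l.length)
    (hlo : ((l.take d0).map (·.2)).sum ≤ ((fs.take jf).flatten).length)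
    (hhi : ((fs.take jf).flatten).length < ((l.take (d0 + 1)).map (·.2)).sum) :
    let ℓ0 := ((fs.take jf).flatten).length
    let q := ((l.take (d0 + 1)).map (·.2)).sum - ℓ0
    let a := (l.get ⟨d0, hd0⟩).1
    let k := (((l.take d0).filter (fun ap => ap.1 = a)).map (·.2)).foldr max 0
    q = (l.get ⟨d0, hd0⟩).2 → k < q →
      (fs.get ⟨jf, hjf⟩).length = max k 1 := by
  intro ℓ0 q a k hq hkq
  obtain ⟨hdec, hpos, hch⟩ := hl
  obtain ⟨hflat, hne, hfac⟩ := hfs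
  set l₁ := l.take d0
  set p := (l.get ⟨d0, hd0⟩).2
  have hsplit : l = l₁ ++ (a, p) :: l.drop (d0 + 1) := by
    conv_lhs => rw [← List.take_append_drop d0 l, List.drop_eq_getElem_cons hd0]
    rfl
  have htake : ((l.take (d0 + 1)).map (·.2)).sum = (rleDecode l₁).length + p := by
    rw [List.take_add_one, List.getElem?_eq_getElem hd0, length_rleDecode, List.map_append,
      List.sum_append]
    simp only [Option.toList_some, List.map_cons, List.map_nil, List.sum_singleton]
    rfl
  have hppos : 1 ≤ p := hpos _ (List.get_mem _ _)
  have hstart : ℓ0 = (rleDecode l₁).length := by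
    have : q = (rleDecode l₁).length + p - ℓ0 := by rw [← htake]
    have : ℓ0 < (rleDecode l₁).length + p := by rw [← htake]; exact hhi
    omega
  have hSdec : S = rleDecode l₁ ++ (List.replicate p a ++ rleDecode (l.drop (d0 + 1))) := by
    rw [← hdec]
    conv_lhs => rw [hsplit]
    rw [rleDecode_append, rleDecode_cons]
  have hdrop : S.drop ℓ0 = List.replicate p a ++ rleDecode (l.drop (d0 + 1)) := by
    rw [hstart]
    conv_lhs => rw [hSdec]
    simp
  set f := fs.get ⟨jf, hjf⟩ with hf
  have hfsplit : S = (fs.take jf).flatten ++ (f ++ (fs.drop (jf + 1)).flatten) := by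
    conv_lhs => rw [← hflat, ← List.take_append_drop jf fs, List.drop_eq_getElem_cons hjf,
      List.flatten_append, List.flatten_cons]
    rfl
  have hfprefix : f <+: S.drop ℓ0 := by
    conv_rhs => rw [hfsplit]
    simp [ℓ0]
  have hprev : (fs.take jf).flatten = rleDecode l₁ := by
    have h₁ : (fs.take jf).flatten <+: S := ⟨_, hfsplit.symm⟩
    have h₂ : rleDecode l₁ <+: S := ⟨_, hSdec.symm⟩
    exact (List.prefix_of_prefix_length_le h₁ h₂ hstart.le).eq_of_length hstart
  have hget : ∀ i < p, (S.drop ℓ0)[i]? = some a := by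
    intro i hi
    rw [hdrop, List.getElem?_append_left (by simpa using hi), List.getElem?_replicate_of_lt hi]
  have hfget : ∀ i < f.length, i < p → f[i]? = some a := by
    intro i hi hip
    rw [← hget i hip, List.getElem?_eq_getElem hi, List.getElem?_eq_getElem
      (hi.trans_le hfprefix.length_le), hfprefix.getElem hi]
  have hflen : 0 < f.length := List.length_pos_iff.2 (hne f (List.get_mem _ _))
  have hhead : f.head? = some a := by
    rw [List.head?_eq_getElem?]
    exact hfget 0 hflen hppos
  obtain ⟨hnew, hold⟩ := hfac jf hjf a hhead
  have hk : k = maxRun a l₁ := rfl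
  rw [hprev, mem_rleDecode_iff_maxRun_ne_zero, ← hk] at hnew hold
  rcases Nat.eq_zero_or_pos k with hk0 | hkpos
  · rw [hf, hnew (by omega)]
    simp [hk0]
  · obtain ⟨⟨j, hj, hocc⟩, hmax⟩ := hold hkpos.ne'
    have hlower : k ≤ f.length := by
      have hrep := hmax (List.replicate k a) (by
          rw [← hstart, hdrop, show p = k + (p - k) by omega, List.replicate_add,
            List.append_assoc]
          exact List.prefix_append _ _) (by
          conv => enter [1]; rw [hSdec]
          exact occursBefore_replicate_of_mem _ hkpos.ne' (maxRun_mem hkpos.ne'))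
      rwa [List.length_replicate] at hrep
    have hupper : min f.length p ≤ k := by
      refine le_maxRun_of_getElem? (p := p)
        (T := List.replicate p a ++ rleDecode (l.drop (d0 + 1))) (j := j)
        (fun x hx => hpos x (List.mem_of_mem_take hx)) ?_ hj fun i hi => ?_
      · rw [hsplit] at hch
        exact hch.prefix ⟨l.drop (d0 + 1), by rw [List.append_assoc, List.singleton_append]⟩
      · have hif : i < f.length := by omega
        rw [← hSdec, ← List.getElem?_drop, ← hfget i hif (by omega),
          List.getElem?_eq_getElem hif, List.getElem?_eq_getElem
          (hif.trans_le hocc.length_le), hocc.getElem hif]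
    omega
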